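/- For every endomorphism a ∈ End(W) and every Ω ∈ Λ³W*, define the 3-form ρ(a)Ω by (ρ(a)Ω)(v₁,v₂,v₃) = Ω(a v₁, v₂, v₃) + Ω(v₁, a v₂, v₃) + Ω(v₁, v₂, a v₃). Then ρ(a)Ω ∧ Ω = tr(a ∘ K_Ω)·ε. (This identity expresses that the moment map for SL(W) acting on the symplectic vector space Λ³W*, with symplectic form ω(Ω₁,Ω₂)·ε = Ω₁ ∧ Ω₂, is Ω ↦ K_Ω.) -/

import Mathlib

open scoped TensorProduct

noncomputable section

/-- The wedge product of alternating forms valued in a commutative algebra,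
obtained from `AlternatingMap.domCoprod` (the sum over shuffles, so that the
wedge of covectors is given by a determinant). -/
def wedge {R A M : Type*} [CommRing R] [CommRing A] [Algebra R A]
    [AddCommGroup M] [Module R M] {m n : ℕ}
    (α : AlternatingMap R M A (Fin m)) (β : AlternatingMap R M A (Fin n)) :
    AlternatingMap R M A (Fin (m + n)) :=
  (LinearMap.mul' R A).compAlternatingMap
    ((α.domCoprod β).domDomCongr finSumFinEquiv)

/-- A linear map regarded as an alternating 1-form. -/
def oneForm {R A M : Type*} [CommRing R] [CommRing A] [Algebra R A]
    [AddCommGroup M] [Module R M] (ξ : M →ₗ[R] A) : AlternatingMap R M A (Fin 1) :=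
  AlternatingMap.ofSubsingleton R M A 0 ξ

/-- A 3-form is decomposable if it is the wedge of three covectors. -/
def IsDecomposable {R A M : Type*} [CommRing R] [CommRing A] [Algebra R A]
    [AddCommGroup M] [Module R M] (α : AlternatingMap R M A (Fin 3)) : Prop :=
  ∃ ξ₁ ξ₂ ξ₃ : M →ₗ[R] A,
    α = wedge (oneForm ξ₁) (wedge (oneForm ξ₂) (oneForm ξ₃))

section aux
variable {W : Type*} [AddCommGroup W] [Module ℝ W]

/-- Tensor product of real-valued multilinear maps, indexed by `Fin`. -/
def mw {m n : ℕ} (f : MultilinearMap ℝ (fun _ : Fin m => W) ℝ)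
    (g : MultilinearMap ℝ (fun _ : Fin n => W) ℝ) :
    MultilinearMap ℝ (fun _ : Fin (m + n) => W) ℝ :=
  (LinearMap.mul' ℝ ℝ).compMultilinearMap ((f.domCoprod g).domDomCongr finSumFinEquiv)

theorem mw_apply {m n : ℕ} (f : MultilinearMap ℝ (fun _ : Fin m => W) ℝ)
    (g : MultilinearMap ℝ (fun _ : Fin n => W) ℝ) (v : Fin (m + n) → W) :
    mw f g v = f (fun i => v (Fin.castAdd n i)) * g (fun i => v (Fin.natAdd m i)) := by
  simp [mw]

theorem alt_mw {m n : ℕ} (f : MultilinearMap ℝ (fun _ : Fin m => W) ℝ)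
    (g : MultilinearMap ℝ (fun _ : Fin n => W) ℝ) :
    MultilinearMap.alternatization (mw f g)
      = wedge (MultilinearMap.alternatization f) (MultilinearMap.alternatization g) := by
  unfold wedge mw
  rw [← MultilinearMap.domCoprod_alternization, LinearMap.compMultilinearMap_alternatization]
  congr 1
  ext v
  simp only [MultilinearMap.alternatization_apply, AlternatingMap.domDomCongr_apply]
  refine Fintype.sum_equiv (finSumFinEquiv.permCongr).symm _ _ fun σ => ?_
  rw [Equiv.permCongr_symm, Equiv.Perm.sign_permCongr]
  congr 1
  simp only [MultilinearMap.domDomCongr_apply]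
  congr 1
  ext i
  simp

theorem wedge_add_left' {m n : ℕ} (α α' : AlternatingMap ℝ W ℝ (Fin m))
    (β : AlternatingMap ℝ W ℝ (Fin n)) :
    wedge (α + α') β = wedge α β + wedge α' β := by
  ext v
  have h := AlternatingMap.domCoprod'.map_add (R := ℝ) (α ⊗ₜ[ℝ] β) (α' ⊗ₜ[ℝ] β)
  rw [← TensorProduct.add_tmul] at h
  simp only [AlternatingMap.domCoprod'_apply] at h
  simp [wedge, h]

theorem wedge_smul_left' {m n : ℕ} (c : ℝ) (α : AlternatingMap ℝ W ℝ (Fin m))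
    (β : AlternatingMap ℝ W ℝ (Fin n)) :
    wedge (c • α) β = c • wedge α β := by
  ext v
  have h := AlternatingMap.domCoprod'.map_smul (R := ℝ) c (α ⊗ₜ[ℝ] β)
  rw [TensorProduct.smul_tmul'] at h
  simp only [AlternatingMap.domCoprod'_apply] at h
  simp [wedge, h]

theorem wedge_smul_right' {m n : ℕ} (c : ℝ) (α : AlternatingMap ℝ W ℝ (Fin m))
    (β : AlternatingMap ℝ W ℝ (Fin n)) :
    wedge α (c • β) = c • wedge α β := by
  ext v
  have h := AlternatingMap.domCoprod'.map_smul (R := ℝ) c (α ⊗ₜ[ℝ] β)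
  rw [← TensorProduct.tmul_smul] at h
  simp only [AlternatingMap.domCoprod'_apply] at h
  simp [wedge, h]

theorem wedge_sum_left' {m n : ℕ} {ι : Type*} (s : Finset ι)
    (α : ι → AlternatingMap ℝ W ℝ (Fin m)) (β : AlternatingMap ℝ W ℝ (Fin n)) :
    wedge (∑ i ∈ s, α i) β = ∑ i ∈ s, wedge (α i) β := by
  classical
  induction s using Finset.induction_on with
  | empty => simpa using wedge_smul_left' (0 : ℝ) 0 β
  | insert i s hi ih => rw [Finset.sum_insert hi, Finset.sum_insert hi, wedge_add_left', ih]

theorem alt_sum_apply {m : ℕ} {ι : Type*} (s : Finset ι)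
    (α : ι → AlternatingMap ℝ W ℝ (Fin m)) (v : Fin m → W) :
    (∑ i ∈ s, α i) v = ∑ i ∈ s, α i v := by
  classical
  induction s using Finset.induction_on with
  | empty => simp
  | insert i s hi ih => rw [Finset.sum_insert hi, Finset.sum_insert hi, AlternatingMap.add_apply, ih]

theorem alt_coe {m : ℕ} (α : AlternatingMap ℝ W ℝ (Fin m)) :
    MultilinearMap.alternatization (α : MultilinearMap ℝ (fun _ : Fin m => W) ℝ)
      = (m.factorial : ℝ) • α := by
  rw [AlternatingMap.coe_alternatization, Fintype.card_fin, Nat.cast_smul_eq_nsmul]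

theorem wedge_assoc' (α : AlternatingMap ℝ W ℝ (Fin 1)) (β : AlternatingMap ℝ W ℝ (Fin 2))
    (γ : AlternatingMap ℝ W ℝ (Fin 3)) :
    (wedge (wedge α β) γ : AlternatingMap ℝ W ℝ (Fin 6)) = wedge α (wedge β γ) := by
  have h : (mw (mw (α : MultilinearMap ℝ (fun _ : Fin 1 => W) ℝ) β.toMultilinearMap)
      γ.toMultilinearMap : MultilinearMap ℝ (fun _ : Fin 6 => W) ℝ)
      = mw α.toMultilinearMap (mw β.toMultilinearMap γ.toMultilinearMap) := by
    ext v
    have e1 := mw_apply (mw α.toMultilinearMap β.toMultilinearMap) γ.toMultilinearMap v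
    have e2 := mw_apply α.toMultilinearMap (mw β.toMultilinearMap γ.toMultilinearMap) v
    refine e1.trans (Eq.trans ?_ e2.symm)
    rw [mw_apply, mw_apply, mul_assoc]
    have q1 : (fun i : Fin 2 => v (Fin.castAdd 3 (Fin.natAdd 1 i)))
        = fun i : Fin 2 => v (Fin.natAdd 1 (Fin.castAdd 3 i)) := by
      ext i; fin_cases i <;> rfl
    have q2 : (fun i : Fin 3 => v (Fin.natAdd (1 + 2) i))
        = fun i : Fin 3 => v (Fin.natAdd 1 (Fin.natAdd 2 i)) := by
      ext i; fin_cases i <;> rfl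
    exact congrArg₂ (· * ·) rfl
      (congrArg₂ (· * ·) (congrArg β q1) (congrArg γ q2))
  have h1 := (alt_mw (mw α.toMultilinearMap β.toMultilinearMap) γ.toMultilinearMap).trans
    (congrArg₂ wedge (alt_mw _ _) rfl)
  have h2 := (alt_mw α.toMultilinearMap (mw β.toMultilinearMap γ.toMultilinearMap)).trans
    (congrArg₂ wedge rfl (alt_mw _ _))
  rw [alt_coe, alt_coe, alt_coe] at h1 h2
  simp only [wedge_smul_left', wedge_smul_right', smul_smul] at h1 h2
  have h3 := h1.symm.trans ((congrArg MultilinearMap.alternatization h).trans h2)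
  have hc : ((Nat.factorial 3 : ℝ) * ((Nat.factorial 2 : ℝ) * (Nat.factorial 1 : ℝ))) ≠ 0 := by
    positivity
  refine smul_right_injective _ hc ?_
  refine Eq.trans ?_ (h3.trans ?_)
  · rfl
  · change _ • wedge α (wedge β γ) = _ • wedge α (wedge β γ)
    congr 1
    ring

theorem wedge_one_two (θ : W →ₗ[ℝ] ℝ) (β : AlternatingMap ℝ W ℝ (Fin 2)) (v : Fin 3 → W) :
    (wedge (oneForm θ) β : AlternatingMap ℝ W ℝ (Fin 3)) v
      = θ (v 0) * β ![v 1, v 2] - θ (v 1) * β ![v 0, v 2] + θ (v 2) * β ![v 0, v 1] := by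
  have h1 := alt_mw (oneForm θ).toMultilinearMap β.toMultilinearMap
  rw [alt_coe, alt_coe] at h1
  simp only [wedge_smul_left', wedge_smul_right', smul_smul] at h1
  have h2 := congrArg (fun f => f v) h1
  have key : ∀ σ : Equiv.Perm (Fin 3),
      (mw (oneForm θ).toMultilinearMap β.toMultilinearMap) (fun i => v (σ i))
        = θ (v (σ 0)) * β ![v (σ 1), v (σ 2)] := by
    intro σ
    refine (mw_apply _ _ _).trans ?_
    have : (fun i : Fin 2 => v (σ (Fin.natAdd 1 i))) = ![v (σ 1), v (σ 2)] := by
      ext i; fin_cases i <;> rfl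
    exact congrArg₂ (· * ·) rfl (congrArg β this)
  have sw : ∀ x y : W, β ![x, y] = - β ![y, x] := by
    intro x y
    have := β.map_swap ![y, x] (i := 0) (j := 1) (by decide)
    rw [← this]
    congr 1
    ext i; fin_cases i <;> rfl
  have h3 : ∑ σ : Equiv.Perm (Fin 3), Equiv.Perm.sign σ •
      (θ (v (σ 0)) * β ![v (σ 1), v (σ 2)]) =
      2 * (wedge (oneForm θ) β : AlternatingMap ℝ W ℝ (Fin 3)) v := by
    refine Eq.trans ?_ (h2.trans ?_)
    · simp only [MultilinearMap.alternatization_apply]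
      exact Finset.sum_congr rfl fun σ _ => by rw [← key]; rfl
    · simp [Nat.factorial]
  have hu : (Finset.univ : Finset (Equiv.Perm (Fin 3))) =
    {1, Equiv.swap 0 1, Equiv.swap 0 2, Equiv.swap 1 2, Equiv.swap 0 1 * Equiv.swap 1 2,
      Equiv.swap 1 2 * Equiv.swap 0 1} := by decide
  rw [hu] at h3
  repeat rw [Finset.sum_insert (by decide)] at h3
  rw [Finset.sum_singleton] at h3
  have a1 : (Equiv.swap (0 : Fin 3) 1) 2 = 2 := by decide
  have a2 : (Equiv.swap (0 : Fin 3) 2) 1 = 1 := by decide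
  have a3 : (Equiv.swap (1 : Fin 3) 2) 0 = 0 := by decide
  have s1 : Equiv.Perm.sign (Equiv.swap (0 : Fin 3) 1) = -1 := by decide
  have s2 : Equiv.Perm.sign (Equiv.swap (0 : Fin 3) 2) = -1 := by decide
  have s3 : Equiv.Perm.sign (Equiv.swap (1 : Fin 3) 2) = -1 := by decide
  simp [a1, a2, a3, s1, s2, s3, Units.smul_def] at h3
  rw [sw (v 2) (v 1), sw (v 1) (v 0), sw (v 2) (v 0)] at h3
  linarith

end aux

/-- For `a ∈ End(W)` and `Ω ∈ Λ³W*`, with `ρ(a)Ω` the 3-form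
`(v₁,v₂,v₃) ↦ Ω(av₁,v₂,v₃) + Ω(v₁,av₂,v₃) + Ω(v₁,v₂,av₃)`, one has
`ρ(a)Ω ∧ Ω = tr(a ∘ K_Ω)·ε`: the moment map for `SL(W)` acting on the
symplectic vector space `Λ³W*` is `Ω ↦ K_Ω`. -/
theorem stmt14 (W : Type*) [AddCommGroup W] [Module ℝ W] [FiniteDimensional ℝ W]
    (hdim : Module.finrank ℝ W = 6)
    (ε : AlternatingMap ℝ W ℝ (Fin 6)) (hε : ε ≠ 0)
    (K : AlternatingMap ℝ W ℝ (Fin 3) → W →ₗ[ℝ] W)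
    (hK : ∀ (Ω : AlternatingMap ℝ W ℝ (Fin 3)) (θ : W →ₗ[ℝ] ℝ) (v : W),
      wedge (oneForm θ) (wedge (Ω.curryLeft v) Ω) = θ (K Ω v) • ε)
    (a : W →ₗ[ℝ] W) (Ω : AlternatingMap ℝ W ℝ (Fin 3))
    (ρaΩ : AlternatingMap ℝ W ℝ (Fin 3))
    (hρ : ∀ v₁ v₂ v₃ : W,
      ρaΩ ![v₁, v₂, v₃] = Ω ![a v₁, v₂, v₃] + Ω ![v₁, a v₂, v₃] + Ω ![v₁, v₂, a v₃]) :
    wedge ρaΩ Ω = LinearMap.trace ℝ W (a ∘ₗ K Ω) • ε := by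
  classical
  let b := Module.finBasis ℝ W
  have hcur : ∀ v x y : W, Ω ![a v, x, y]
      = ∑ i, b.coord i v * Ω.curryLeft (a (b i)) ![x, y] := by
    intro v x y
    have h0 : a v = ∑ i, b.coord i v • a (b i) := by
      have h := congrArg a (b.sum_repr v)
      rw [map_sum] at h
      rw [← h]
      simp only [map_smul, Module.Basis.coord_apply]
    have h3 : Ω ![a v, x, y] = Ω.curryLeft (a v) ![x, y] := rfl
    rw [h3, h0, map_sum, alt_sum_apply]
    simp
  have sw1 : ∀ x y z : W, Ω ![x, y, z] = - Ω ![y, x, z] := by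
    intro x y z
    rw [← Ω.map_swap ![y, x, z] (i := 0) (j := 1) (by decide)]
    congr 1
    ext i; fin_cases i <;> rfl
  have sw2 : ∀ x y z : W, Ω ![x, y, z] = - Ω ![x, z, y] := by
    intro x y z
    rw [← Ω.map_swap ![x, z, y] (i := 1) (j := 2) (by decide)]
    congr 1
    ext i; fin_cases i <;> rfl
  have hsum : ρaΩ = ∑ i, (wedge (oneForm (b.coord i)) (Ω.curryLeft (a (b i))) :
      AlternatingMap ℝ W ℝ (Fin 3)) := by
    ext v
    have hv : v = ![v 0, v 1, v 2] := by ext i; fin_cases i <;> rfl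
    rw [alt_sum_apply]
    simp only [wedge_one_two]
    rw [Finset.sum_add_distrib, Finset.sum_sub_distrib, ← hcur, ← hcur, ← hcur]
    conv_lhs => rw [hv]
    rw [hρ, sw1 (v 0) (a (v 1)), sw2 (v 0) (v 1), sw1 (v 0) (a (v 2))]
    ring
  have htr : LinearMap.trace ℝ W (a ∘ₗ K Ω) = ∑ i, b.coord i (K Ω (a (b i))) := by
    rw [LinearMap.trace_comp_comm', LinearMap.trace_eq_matrix_trace ℝ b, Matrix.trace]
    simp [LinearMap.toMatrix_apply]
  rw [htr, Finset.sum_smul, hsum, wedge_sum_left']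
  refine Finset.sum_congr rfl fun i _ => ?_
  rw [← hK]
  exact wedge_assoc' _ _ _
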